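/- Let p be an odd prime. The dual lattice of L₁^{sp} with respect to the bilinear form B(x,y) = −tr(xy) is L₁^{sp,♯} = {[[a,b],[c,−a]] : a, c ∈ ℤ_p, b ∈ p⁻¹ℤ_p}. -/

import Mathlib

/-- The bilinear form `B(x,y) = -tr(x*y)` on trace-zero `2×2` matrices over `ℚ_p`. -/
noncomputable def Bsp (p : ℕ) [Fact p.Prime] (x y : Matrix (Fin 2) (Fin 2) ℚ_[p]) : ℚ_[p] :=
  - Matrix.trace (x * y)

/-- `L₁^{sp}`: trace-zero `2×2` matrices with entries in `ℤ_p` whose lower-left entry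
lies in `pℤ_p`. -/
def L1sp (p : ℕ) [Fact p.Prime] : Set (Matrix (Fin 2) (Fin 2) ℚ_[p]) :=
  {x | Matrix.trace x = 0 ∧ (∀ i j, ‖x i j‖ ≤ 1) ∧ ‖(p : ℚ_[p])⁻¹ * x 1 0‖ ≤ 1}

/-- The dual lattice of a lattice `L` inside `V^{sp}` with respect to `B(x,y) = -tr(xy)`:
all trace-zero matrices pairing integrally with every element of `L`. -/
noncomputable def dualLat (p : ℕ) [Fact p.Prime] (L : Set (Matrix (Fin 2) (Fin 2) ℚ_[p])) :
    Set (Matrix (Fin 2) (Fin 2) ℚ_[p]) :=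
  {x | Matrix.trace x = 0 ∧ ∀ y ∈ L, ‖Bsp p x y‖ ≤ 1}

/-- The entrywise formula for `B` on trace-zero matrices. -/
lemma Bsp_eq {p : ℕ} [Fact p.Prime] {x y : Matrix (Fin 2) (Fin 2) ℚ_[p]}
    (hx : x 1 1 = -x 0 0) (hy : y 1 1 = -y 0 0) :
    Bsp p x y = -(2 * (x 0 0 * y 0 0) + (p * x 0 1) * ((p : ℚ_[p])⁻¹ * y 1 0) +
      x 1 0 * y 0 1) := by
  have hp0 : (p : ℚ_[p]) ≠ 0 := Nat.cast_ne_zero.2 (Fact.out : p.Prime).ne_zero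
  simp only [Bsp, Matrix.trace_fin_two, Matrix.mul_apply, Fin.sum_univ_two, hx, hy]
  field_simp
  ring

/-- A trace-zero `2×2` matrix is determined on the diagonal by its upper-left entry. -/
lemma trace_fin_two_eq_zero_iff {R : Type*} [AddCommGroup R] {x : Matrix (Fin 2) (Fin 2) R} :
    x.trace = 0 ↔ x 1 1 = -x 0 0 := by
  rw [Matrix.trace_fin_two, add_comm, add_eq_zero_iff_eq_neg]

lemma Padic.norm_two_of_odd {p : ℕ} [Fact p.Prime] (hp : Odd p) : ‖(2 : ℚ_[p])‖ = 1 := by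
  have h := Padic.norm_natCast_eq_one_iff (p := p) (n := 2)
  exact_mod_cast h.2 (Nat.coprime_two_right.2 hp)

/-- For an odd prime `p`, the dual of `L₁^{sp}` is
`{[[a,b],[c,-a]] : a, c ∈ ℤ_p, b ∈ p⁻¹ℤ_p}`. -/
theorem L1sp_dual (p : ℕ) [Fact p.Prime] (hp : Odd p) :
    dualLat p (L1sp p) =
      {x : Matrix (Fin 2) (Fin 2) ℚ_[p] |
        x 1 1 = - x 0 0 ∧ ‖x 0 0‖ ≤ 1 ∧ ‖x 1 0‖ ≤ 1 ∧ ‖(p : ℚ_[p]) * x 0 1‖ ≤ 1} := by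
  have hp0 : (p : ℚ_[p]) ≠ 0 := Nat.cast_ne_zero.2 (Fact.out : p.Prime).ne_zero
  have hp1 : ‖(p : ℚ_[p])‖ ≤ 1 := Padic.norm_p_lt_one.le
  have h2 := Padic.norm_two_of_odd hp
  ext x
  simp only [dualLat, L1sp, Set.mem_ofPred_eq, trace_fin_two_eq_zero_iff]
  refine and_congr_right fun hx ↦ ⟨fun h ↦ ⟨?_, ?_, ?_⟩, ?_⟩
  · have hB := h !![1, 0; 0, -1] (by simp [Fin.forall_fin_two])
    rw [Bsp_eq hx (by simp)] at hB
    simpa [h2] using hB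
  · have hB := h !![0, 1; 0, 0] (by simp [Fin.forall_fin_two])
    rw [Bsp_eq hx (by simp)] at hB
    simpa using hB
  · have hB := h !![0, 0; (p : ℚ_[p]), 0] (by simp [Fin.forall_fin_two, hp0, hp1, -Padic.norm_p])
    rw [Bsp_eq hx (by simp)] at hB
    simpa [hp0, -Padic.norm_p, -norm_mul] using hB
  · rintro ⟨ha, hc, hb⟩ y ⟨hy, hy1, hy2⟩
    have hmul {u v : ℚ_[p]} (hu : ‖u‖ ≤ 1) (hv : ‖v‖ ≤ 1) : ‖u * v‖ ≤ 1 := by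
      rw [norm_mul]
      exact mul_le_one₀ hu (norm_nonneg v) hv
    have hadd {u v : ℚ_[p]} (hu : ‖u‖ ≤ 1) (hv : ‖v‖ ≤ 1) : ‖u + v‖ ≤ 1 :=
      (Padic.nonarchimedean u v).trans (max_le hu hv)
    rw [Bsp_eq hx hy, norm_neg]
    exact hadd (hadd (hmul h2.le (hmul ha (hy1 0 0))) (hmul hb hy2)) (hmul hc (hy1 0 1))
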